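/- Let α ∈ (1/2,1), σ > 0, φ(t) = ασ(1+σt)^{-(α+1)}, and let R_α(t) = ∑_{k=1}^∞ φ^{*k}(t). Then R_α(t) is regularly varying of index α−1 at infinity in the precise sense that there exists a constant C > 0 such that lim_{t→∞} R_α(t) / t^{α−1} = C. -/

import Mathlib

open MeasureTheory Real Filter Set

/-- Convolution of two functions on `[0,∞)`: `(f * g)(t) = ∫_0^t f(t-s) g(s) ds`. -/
noncomputable def conv (f g : ℝ → ℝ) : ℝ → ℝ := fun t => ∫ s in (0:ℝ)..t, f (t - s) * g s

/-- Convolution powers: `convPow f k = f^{*(k+1)}`, i.e. `convPow f 0 = f`. -/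
noncomputable def convPow (f : ℝ → ℝ) : ℕ → ℝ → ℝ
  | 0 => f
  | (k + 1) => conv f (convPow f k)

lemma conv_cont {f g : ℝ → ℝ} (hf : Continuous f) (hg : Continuous g) : Continuous (conv f g) := by
  unfold conv
  apply intervalIntegral.continuous_parametric_intervalIntegral_of_continuous
  · fun_prop
  · fun_prop

lemma convPow_cont {f : ℝ → ℝ} (hf : Continuous f) (k : ℕ) : Continuous (convPow f k) := by
  induction k with
  | zero => exact hf
  | succ k ih => exact conv_cont hf ih

lemma convPow_congr {f f' : ℝ → ℝ} (h : ∀ t, 0 ≤ t → f t = f' t) (k : ℕ) :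
    ∀ t, 0 ≤ t → convPow f k t = convPow f' k t := by
  induction k with
  | zero => exact h
  | succ k ih =>
    intro t ht
    change conv f (convPow f k) t = conv f' (convPow f' k) t
    unfold conv
    apply intervalIntegral.integral_congr
    intro s hs
    rw [uIcc_of_le ht] at hs
    change f (t - s) * convPow f k s = f' (t - s) * convPow f' k s
    rw [h (t - s) (by linarith [hs.2]), ih s hs.1]

lemma convPow_nonneg {f : ℝ → ℝ} (h : ∀ t, 0 ≤ f t) (k : ℕ) :
    ∀ t, 0 ≤ t → 0 ≤ convPow f k t := by
  induction k with
  | zero => exact fun t _ => h t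
  | succ k ih =>
    intro t ht
    change 0 ≤ ∫ s in (0:ℝ)..t, f (t - s) * convPow f k s
    apply intervalIntegral.integral_nonneg ht
    intro s hs
    exact mul_nonneg (h _) (ih s hs.1)

lemma convPow_bound {f : ℝ → ℝ} (hc : Continuous f) (h : ∀ t, 0 ≤ f t) {M T : ℝ}
    (hM : ∀ t, f t ≤ M) (k : ℕ) :
    ∀ t, 0 ≤ t → t ≤ T → convPow f k t ≤ M * (∫ s in (0:ℝ)..T, f s) ^ k := by
  have hM0 : 0 ≤ M := (h 0).trans (hM 0)
  induction k with
  | zero => intro t _ _; simpa [convPow] using hM t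
  | succ k ih =>
    intro t ht htT
    set q := ∫ s in (0:ℝ)..T, f s with hq
    have hq0 : 0 ≤ q := intervalIntegral.integral_nonneg (ht.trans htT) (fun s _ => h s)
    have hqt : ∫ s in (0:ℝ)..t, f s ≤ q :=
      intervalIntegral.integral_mono_interval le_rfl ht htT
        (Eventually.of_forall h) (hc.intervalIntegrable _ _)
    change ∫ s in (0:ℝ)..t, f (t - s) * convPow f k s ≤ _
    have hck := convPow_cont hc k
    calc ∫ s in (0:ℝ)..t, f (t - s) * convPow f k s
        ≤ ∫ s in (0:ℝ)..t, f (t - s) * (M * q ^ k) := by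
          apply intervalIntegral.integral_mono_on ht
          · apply Continuous.intervalIntegrable; fun_prop
          · apply Continuous.intervalIntegrable; fun_prop
          · intro s hs
            exact mul_le_mul_of_nonneg_left (ih s hs.1 (hs.2.trans htT)) (h _)
      _ = (∫ s in (0:ℝ)..t, f s) * (M * q ^ k) := by
          rw [intervalIntegral.integral_mul_const]
          congr 1
          rw [intervalIntegral.integral_comp_sub_left (fun x => f x)]
          simp
      _ ≤ q * (M * q ^ k) := by gcongr
      _ = M * q ^ (k+1) := by ring

/-- The renewal density, extended to be constant on the negatives. -/
noncomputable def renDens (f : ℝ → ℝ) (t : ℝ) : ℝ := ∑' k : ℕ, convPow f k (max t 0)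

lemma convPow_summable {f : ℝ → ℝ} (hc : Continuous f) (h : ∀ t, 0 ≤ f t) {M : ℝ}
    (hM : ∀ t, f t ≤ M) (hq : ∀ T, 0 ≤ T → ∫ s in (0:ℝ)..T, f s < 1) (t : ℝ) (ht : 0 ≤ t) :
    Summable (fun k => convPow f k t) := by
  have hq0 : 0 ≤ ∫ s in (0:ℝ)..t, f s := intervalIntegral.integral_nonneg ht (fun s _ => h s)
  exact Summable.of_nonneg_of_le (fun k => convPow_nonneg h k t ht)
    (fun k => convPow_bound hc h hM k t ht le_rfl)
    ((summable_geometric_of_lt_one hq0 (hq t ht)).mul_left M)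

lemma renDens_cont {f : ℝ → ℝ} (hc : Continuous f) (h : ∀ t, 0 ≤ f t) {M : ℝ}
    (hM : ∀ t, f t ≤ M) (hq : ∀ T, 0 ≤ T → ∫ s in (0:ℝ)..T, f s < 1) :
    Continuous (renDens f) := by
  rw [continuous_iff_continuousAt]
  intro t
  set T := max t 0 + 1
  have hT : 0 ≤ T := by positivity
  have hq0 : 0 ≤ ∫ s in (0:ℝ)..T, f s := intervalIntegral.integral_nonneg hT (fun s _ => h s)
  have : ContinuousOn (renDens f) (Iio T) := by
    unfold renDens
    apply continuousOn_tsum (u := fun k => M * (∫ s in (0:ℝ)..T, f s) ^ k)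
    · intro k
      have := convPow_cont hc k
      fun_prop
    · exact (summable_geometric_of_lt_one hq0 (hq T hT)).mul_left M
    · intro k x hx
      rw [Real.norm_of_nonneg (convPow_nonneg h k _ (le_max_right _ _))]
      exact convPow_bound hc h hM k _ (le_max_right _ _) (max_le (le_of_lt hx) hT)
  apply this.continuousAt
  apply Iio_mem_nhds
  have := le_max_left t 0
  simp only [T]; linarith

lemma renDens_nonneg {f : ℝ → ℝ} (h : ∀ t, 0 ≤ f t) (t : ℝ) : 0 ≤ renDens f t :=
  tsum_nonneg (fun k => convPow_nonneg h k _ (le_max_right _ _))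

lemma renDens_eq {f : ℝ → ℝ} (hc : Continuous f) (h : ∀ t, 0 ≤ f t) {M : ℝ}
    (hM : ∀ t, f t ≤ M) (hq : ∀ T, 0 ≤ T → ∫ s in (0:ℝ)..T, f s < 1) (t : ℝ) (ht : 0 ≤ t) :
    renDens f t = f t + ∫ s in (0:ℝ)..t, f (t - s) * renDens f s := by
  have hq0 : 0 ≤ ∫ s in (0:ℝ)..t, f s := intervalIntegral.integral_nonneg ht (fun s _ => h s)
  have hM0 : 0 ≤ M := (h 0).trans (hM 0)
  have key : HasSum (fun k => ∫ s in (0:ℝ)..t, f (t - s) * convPow f k s)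
      (∫ s in (0:ℝ)..t, f (t - s) * renDens f s) := by
    apply intervalIntegral.hasSum_integral_of_dominated_convergence
      (fun k _ => M * (M * (∫ s in (0:ℝ)..t, f s) ^ k))
    · intro k
      have := convPow_cont hc k
      apply Continuous.aestronglyMeasurable
      fun_prop
    · intro k
      refine Eventually.of_forall fun s hs => ?_
      rw [uIoc_of_le ht] at hs
      have h1 := convPow_nonneg h k s hs.1.le
      rw [Real.norm_of_nonneg (mul_nonneg (h _) h1)]
      exact mul_le_mul (hM _) (convPow_bound hc h hM k s hs.1.le hs.2) h1 hM0
    · refine Eventually.of_forall fun s hs => ?_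
      exact ((summable_geometric_of_lt_one hq0 (hq t ht)).mul_left M).mul_left M
    · simp
    · refine Eventually.of_forall fun s hs => ?_
      rw [uIoc_of_le ht] at hs
      apply HasSum.mul_left
      unfold renDens
      rw [max_eq_left hs.1.le]
      exact (convPow_summable hc h hM hq s hs.1.le).hasSum
  have hs := convPow_summable hc h hM hq t ht
  unfold renDens at key ⊢
  rw [max_eq_left ht, hs.tsum_eq_zero_add]
  congr 1
  exact key.tsum_eq

/-- Monotonicity of the renewal density. -/
lemma antitone_of_renewal {f R Fb : ℝ → ℝ} (hc : Continuous f) (h : ∀ t, 0 ≤ t → 0 < f t)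
    (hR : Continuous R) (hR0 : ∀ t, 0 ≤ R t)
    (hFb : ∀ t, 0 ≤ t → 0 < Fb t)
    (hF : ∀ t, 0 ≤ t → ∫ s in (0:ℝ)..t, f s = 1 - Fb t)
    (hren : ∀ t, 0 ≤ t → R t = f t + ∫ s in (0:ℝ)..t, f (t - s) * R s)
    (hlc : ∀ a t u, 0 ≤ a → a ≤ t → 0 ≤ u → f (a + u) * f t ≤ f (t + u) * f a)
    (hhaz : ∀ t u, 0 ≤ t → 0 ≤ u → f (t + u) * Fb t ≤ f t * Fb (t + u)) :
    AntitoneOn R (Ici 0) := by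
  by_contra hcon
  simp only [AntitoneOn, not_forall] at hcon
  obtain ⟨s0, hs0, t1, ht1, hst, hlt⟩ := hcon
  push Not at hlt
  simp only [mem_Ici] at hs0 ht1
  obtain ⟨t, htmem, htmin⟩ := (isCompact_Icc (a := (0:ℝ)) (b := t1)).exists_isMinOn
    ⟨s0, hs0, hst⟩ hR.continuousOn
  have hmin : ∀ s, 0 ≤ s → s ≤ t1 → R t ≤ R s := fun s h1 h2 => htmin ⟨h1, h2⟩
  obtain ⟨t2, ht2mem, ht2max⟩ := (isCompact_Icc (a := t) (b := t1)).exists_isMaxOn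
    ⟨t1, htmem.2, le_rfl⟩ hR.continuousOn
  have hmax : ∀ s, t ≤ s → s ≤ t1 → R s ≤ R t2 := fun s h1 h2 => ht2max ⟨h1, h2⟩
  have hgt : R t < R t2 := by
    calc R t ≤ R s0 := hmin s0 hs0 hst
      _ < R t1 := hlt
      _ ≤ R t2 := hmax t1 htmem.2 le_rfl
  have ht0 := htmem.1
  obtain ⟨u, hu, rfl⟩ : ∃ u, 0 ≤ u ∧ t2 = t + u := ⟨t2 - t, by linarith [ht2mem.1], by ring⟩
  set M := R (t + u)
  set ρ := f (t + u) / f t with hρ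
  have hft := h t ht0
  have hρf : f (t+u) = ρ * f t := by rw [hρ]; field_simp
  have e1 := hren (t + u) (by linarith)
  have e2 := hren t ht0
  have ii : ∀ (F : ℝ → ℝ) (a b : ℝ), Continuous F → IntervalIntegrable F volume a b :=
    fun F a b hF => hF.intervalIntegrable a b
  have split : ∫ s in (0:ℝ)..(t+u), f (t + u - s) * R s =
      (∫ s in (0:ℝ)..t, f (t + u - s) * R s) + ∫ s in t..(t+u), f (t + u - s) * R s := by
    rw [intervalIntegral.integral_add_adjacent_intervals] <;> apply ii <;> fun_prop
  have b2 : ∫ s in t..(t+u), f (t + u - s) * R s ≤ (1 - Fb u) * M := by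
    calc _ ≤ ∫ s in t..(t+u), f (t + u - s) * M := by
          apply intervalIntegral.integral_mono_on (by linarith)
          · apply ii; fun_prop
          · apply ii; fun_prop
          · intro s hs
            apply mul_le_mul_of_nonneg_left _ (h _ (by linarith [hs.2])).le
            exact hmax s hs.1 (hs.2.trans ht2mem.2)
      _ = (1 - Fb u) * M := by
          rw [intervalIntegral.integral_mul_const,
            intervalIntegral.integral_comp_sub_left (fun x => f x)]
          rw [← hF u hu]; simp
  have b1 : ∫ s in (0:ℝ)..t, f (t + u - s) * (R s - R t) ≤
      ρ * ∫ s in (0:ℝ)..t, f (t - s) * (R s - R t) := by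
    rw [← intervalIntegral.integral_const_mul]
    apply intervalIntegral.integral_mono_on ht0
    · apply ii; fun_prop
    · apply ii; fun_prop
    · intro s hs
      rw [← mul_assoc]
      apply mul_le_mul_of_nonneg_right
      · have := hlc (t - s) t u (by linarith [hs.2]) (by linarith [hs.1]) hu
        rw [hρf] at this
        have h3 : t + u - s = t - s + u := by ring
        rw [h3]
        have : f (t - s + u) * f t ≤ (ρ * f (t - s)) * f t := by linarith
        exact le_of_mul_le_mul_right this hft
      · linarith [hmin s hs.1 (hs.2.trans htmem.2)]
  have c1 : ∫ s in (0:ℝ)..t, f (t + u - s) * (R s - R t) =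
      (∫ s in (0:ℝ)..t, f (t + u - s) * R s) - (Fb u - Fb (t+u)) * R t := by
    simp_rw [mul_sub]
    rw [intervalIntegral.integral_sub (by apply ii; fun_prop) (by apply ii; fun_prop),
      intervalIntegral.integral_mul_const,
      intervalIntegral.integral_comp_sub_left (fun x => f x)]
    congr 2
    have := intervalIntegral.integral_add_adjacent_intervals (ii f 0 u hc) (ii f u (t+u) hc)
    rw [hF u hu, hF (t+u) (by linarith)] at this
    have e : t + u - t = u := by ring
    rw [e, sub_zero]; linarith
  have c2 : ∫ s in (0:ℝ)..t, f (t - s) * (R s - R t) =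
      (∫ s in (0:ℝ)..t, f (t - s) * R s) - (1 - Fb t) * R t := by
    simp_rw [mul_sub]
    rw [intervalIntegral.integral_sub (by apply ii; fun_prop) (by apply ii; fun_prop),
      intervalIntegral.integral_mul_const,
      intervalIntegral.integral_comp_sub_left (fun x => f x)]
    congr 2
    rw [← hF t ht0]; simp
  rw [c1, c2] at b1
  have hI : ∫ s in (0:ℝ)..t, f (t - s) * R s = R t - f t := by linarith
  rw [hI] at b1
  rw [split] at e1
  have hz : ρ * Fb t ≤ Fb (t+u) := by
    have := hhaz t u ht0 hu
    rw [hρf] at this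
    have : ρ * Fb t * f t ≤ Fb (t+u) * f t := by linarith
    exact le_of_mul_le_mul_right this hft
  have fin : M * Fb u ≤ R t * Fb u := by
    have := mul_le_mul_of_nonneg_right hz (hR0 t)
    have e1' : M = f (t+u) + ((∫ s in (0:ℝ)..t, f (t + u - s) * R s) +
      ∫ s in t..(t+u), f (t + u - s) * R s) := e1
    nlinarith
  have := le_of_mul_le_mul_right fin (hFb u hu)
  linarith

lemma conv_fubini {f R r : ℝ → ℝ} (hf : Continuous f) (hR : Continuous R) {t : ℝ} (ht : 0 ≤ t)
    (hr : IntervalIntegrable r volume 0 t) :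
    ∫ s in (0:ℝ)..t, R (t - s) * (∫ u in (0:ℝ)..s, f (s - u) * r u) =
    ∫ u in (0:ℝ)..t, (∫ v in (0:ℝ)..(t - u), R (t - u - v) * f v) * r u := by
  have hr' : Integrable r (volume.restrict (Ioc 0 t)) :=
    (intervalIntegrable_iff_integrableOn_Ioc_of_le ht).1 hr
  set D : Set (ℝ × ℝ) := {p | p.2 ≤ p.1} with hD
  have hDm : MeasurableSet D := measurableSet_le measurable_snd measurable_fst
  set H : ℝ → ℝ → ℝ := fun s u => D.indicator (fun p => R (t - p.1) * f (p.1 - p.2) * r p.2) (s, u)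
    with hH
  obtain ⟨A, hA⟩ := (isCompact_Icc (a := (0:ℝ)) (b := t)).exists_bound_of_continuousOn
    (f := R) hR.continuousOn
  obtain ⟨B, hB⟩ := (isCompact_Icc (a := (0:ℝ)) (b := t)).exists_bound_of_continuousOn
    (f := f) hf.continuousOn
  have hA0 : 0 ≤ A := (norm_nonneg _).trans (hA 0 ⟨le_rfl, ht⟩)
  have hB0 : 0 ≤ B := (norm_nonneg _).trans (hB 0 ⟨le_rfl, ht⟩)
  have hint : Integrable (Function.uncurry H)
      ((volume.restrict (Ioc 0 t)).prod (volume.restrict (Ioc 0 t))) := by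
    have h1 : Integrable (fun p : ℝ × ℝ => (A * B) * r p.2)
      ((volume.restrict (Ioc 0 t)).prod (volume.restrict (Ioc 0 t))) :=
      (integrable_const (A * B)).mul_prod hr'
    refine h1.mono ?_ ?_
    · have : Function.uncurry H = D.indicator (fun p => R (t - p.1) * f (p.1 - p.2) * r p.2) := by
        ext ⟨s, u⟩; rfl
      rw [this]
      apply AEStronglyMeasurable.indicator _ hDm
      apply AEStronglyMeasurable.mul
      · apply Continuous.aestronglyMeasurable; fun_prop
      · exact hr'.aestronglyMeasurable.comp_snd
    · rw [Measure.prod_restrict]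
      refine (ae_restrict_mem (measurableSet_Ioc.prod measurableSet_Ioc)).mono ?_
      rintro ⟨s, u⟩ ⟨hs, hu⟩
      simp only [Function.uncurry, hH]
      by_cases hsu : (s, u) ∈ D
      · rw [indicator_of_mem hsu]
        have hsu' : u ≤ s := hsu
        simp only [mem_Ioc] at hs hu
        have h2 := hA (t - s) ⟨by linarith, by linarith⟩
        have h3 := hB (s - u) ⟨by linarith, by linarith⟩
        rw [norm_mul, norm_mul, norm_mul, Real.norm_of_nonneg (mul_nonneg hA0 hB0)]
        gcongr
      · rw [indicator_of_notMem hsu, norm_zero]; exact norm_nonneg _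
  have swap := integral_integral_swap hint
  rw [intervalIntegral.integral_of_le ht, intervalIntegral.integral_of_le ht]
  convert swap using 1
  · apply setIntegral_congr_fun measurableSet_Ioc
    intro s hs
    simp only [mem_Ioc] at hs
    have e : ∀ u, H s u = (Iic s).indicator (fun u => R (t - s) * (f (s - u) * r u)) u := by
      intro u
      simp only [hH, hD, indicator, mem_ofPred_eq, mem_Iic, mul_assoc]
    simp_rw [e]
    rw [setIntegral_indicator measurableSet_Iic, Ioc_inter_Iic, min_eq_right hs.2,
      integral_const_mul, intervalIntegral.integral_of_le hs.1.le]
  · apply setIntegral_congr_fun measurableSet_Ioc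
    intro u hu
    simp only [mem_Ioc] at hu
    have e : ∀ s, H s u = (Ici u).indicator (fun s => (R (t - s) * f (s - u)) * r u) s := by
      intro s
      simp only [hH, hD, indicator, mem_ofPred_eq, mem_Ici]
    simp_rw [e]
    have e2 : Ioc 0 t ∩ Ici u = Icc u t := by
      ext x; simp only [mem_inter_iff, mem_Ioc, mem_Ici, mem_Icc]
      constructor
      · rintro ⟨⟨_, h⟩, h'⟩; exact ⟨h', h⟩
      · rintro ⟨h, h'⟩; exact ⟨⟨by linarith, h'⟩, h⟩
    rw [setIntegral_indicator measurableSet_Ici, e2, integral_mul_const,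
      integral_Icc_eq_integral_Ioc, ← intervalIntegral.integral_of_le hu.2]
    congr 1
    have := intervalIntegral.integral_comp_sub_right (a := u) (b := t)
      (fun v => R (t - u - v) * f v) u
    simp only [sub_self] at this
    rw [← this]
    congr 1; ext s; congr 2; ring

lemma renewal_smooth {f R r w : ℝ → ℝ} (hf : Continuous f) (hR : Continuous R)
    (hren : ∀ t, 0 ≤ t → R t = f t + ∫ s in (0:ℝ)..t, f (t - s) * R s)
    (hr : ∀ t, 0 ≤ t → IntervalIntegrable r volume 0 t)
    (hwi : ∀ t, 0 ≤ t → IntervalIntegrable w volume 0 t)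
    (hw : ∀ t, 0 ≤ t → ∫ s in (0:ℝ)..t, f (t - s) * r s = w t) {t : ℝ} (ht : 0 ≤ t) :
    ∫ s in (0:ℝ)..t, R (t - s) * (r s - w s) = w t := by
  have h1 := conv_fubini hf hR ht (hr t ht)
  have h2 : ∫ s in (0:ℝ)..t, R (t - s) * (∫ u in (0:ℝ)..s, f (s - u) * r u) =
      ∫ s in (0:ℝ)..t, R (t - s) * w s := by
    apply intervalIntegral.integral_congr
    intro s hs
    rw [uIcc_of_le ht] at hs
    simp only []
    rw [hw s hs.1]
  have h3 : ∫ u in (0:ℝ)..t, (∫ v in (0:ℝ)..(t - u), R (t - u - v) * f v) * r u =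
      ∫ u in (0:ℝ)..t, (R (t - u) * r u - f (t - u) * r u) := by
    apply intervalIntegral.integral_congr
    intro u hu
    rw [uIcc_of_le ht] at hu
    have hx : 0 ≤ t - u := by linarith [hu.2]
    have := hren (t - u) hx
    have e := intervalIntegral.integral_comp_sub_left (a := 0) (b := t - u)
      (fun s => f (t - u - s) * R s) (t - u)
    simp only [sub_self, sub_zero] at e
    have e' : ∫ v in (0:ℝ)..(t - u), R (t - u - v) * f v = R (t - u) - f (t - u) := by
      rw [eq_sub_iff_add_eq, add_comm, this, ← e]
      congr 2; ext v; rw [mul_comm]; congr 2; ring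
    simp only []
    rw [e']; ring
  have cm : ∀ (F q : ℝ → ℝ), Continuous F → IntervalIntegrable q volume 0 t →
      IntervalIntegrable (fun s => F (t - s) * q s) volume 0 t := by
    intro F q hF hq
    apply hq.continuousOn_mul
    fun_prop
  rw [intervalIntegral.integral_sub (cm R r hR (hr t ht)) (cm f r hf (hr t ht)), hw t ht] at h3
  simp_rw [mul_sub]
  rw [intervalIntegral.integral_sub (cm R r hR (hr t ht)) (cm R w hR (hwi t ht)), ← h2, h1, h3]
  ring

section asymp
variable {α σ : ℝ}

lemma g_nonneg (hσ : 0 < σ) {s : ℝ} (hs : 0 ≤ s) : 0 ≤ s ^ (α - 1) / (1 + σ * s) := by positivity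

lemma g_pos (hσ : 0 < σ) {s : ℝ} (hs : 0 < s) : 0 < s ^ (α - 1) / (1 + σ * s) := by positivity

lemma g_anti (hα1 : α < 1) (hσ : 0 < σ) {s t : ℝ} (hs : 0 < s) (hst : s ≤ t) :
    t ^ (α - 1) / (1 + σ * t) ≤ s ^ (α - 1) / (1 + σ * s) := by
  have : t ^ (α - 1) ≤ s ^ (α - 1) := rpow_le_rpow_of_nonpos hs hst (by linarith)
  gcongr

lemma g_le (hσ : 0 < σ) {s : ℝ} (hs : 0 < s) :
    s ^ (α - 1) / (1 + σ * s) ≤ s ^ (α - 2) / σ := by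
  have h : s ^ (α - 1) = s ^ (α - 2) * s := by
    rw [← rpow_add_one hs.ne']; congr 1; ring
  rw [h, div_le_div_iff₀ (by positivity) hσ]
  have : 0 < s ^ (α - 2) := by positivity
  nlinarith

lemma g_intervalIntegrable (hα0 : 0 < α) (hσ : 0 < σ) {t : ℝ} (ht : 0 ≤ t) :
    IntervalIntegrable (fun s => s ^ (α - 1) / (1 + σ * s)) volume 0 t := by
  have h := intervalIntegral.intervalIntegrable_rpow' (a := 0) (b := t) (r := α - 1) (by linarith)
  simp_rw [div_eq_mul_inv]
  apply h.mul_continuousOn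
  rw [uIcc_of_le ht]
  apply ContinuousOn.inv₀ (by fun_prop)
  intro s hs
  have := mul_nonneg hσ.le hs.1
  linarith

lemma g_integrable (hα0 : 0 < α) (hα1 : α < 1) (hσ : 0 < σ) :
    IntegrableOn (fun s => s ^ (α - 1) / (1 + σ * s)) (Ioi 0) := by
  rw [← Ioc_union_Ioi_eq_Ioi (zero_le_one (α := ℝ))]
  apply IntegrableOn.union
  · exact (intervalIntegrable_iff_integrableOn_Ioc_of_le zero_le_one).1
      (g_intervalIntegrable hα0 hσ zero_le_one)
  · have h := (integrableOn_Ioi_rpow_of_lt (a := α - 2) (c := 1) (by linarith) one_pos).div_const σ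
    refine Integrable.mono' h ?_ ?_
    · apply Measurable.aestronglyMeasurable; fun_prop
    · refine (ae_restrict_mem measurableSet_Ioi).mono ?_
      intro s hs
      have hs0 : 0 < s := lt_trans one_pos hs
      rw [Real.norm_of_nonneg (g_nonneg hσ hs0.le)]
      exact g_le hσ hs0

lemma asymp_main (hα0 : 0 < α) (hα1 : α < 1) (hσ : 0 < σ) {R : ℝ → ℝ} (hR : Continuous R)
    (hR0 : ∀ t, 0 ≤ R t) (hanti : AntitoneOn R (Ici 0))
    (hid : ∀ t, 0 < t → ∫ s in (0:ℝ)..t, R (t - s) * (s ^ (α - 1) / (1 + σ * s)) =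
      t ^ (α - 1) * (σ * t / (1 + σ * t))) :
    ∃ C : ℝ, 0 < C ∧ Tendsto (fun t : ℝ => R t / t ^ (α - 1)) atTop (nhds C) := by
  set g : ℝ → ℝ := fun s => s ^ (α - 1) / (1 + σ * s) with hg
  set m := ∫ s in Ioi (0:ℝ), g s with hm
  have hgint : IntegrableOn g (Ioi 0) := g_integrable hα0 hα1 hσ
  have hgii : ∀ t, 0 ≤ t → IntervalIntegrable g volume 0 t :=
    fun t ht => g_intervalIntegrable hα0 hσ ht
  set G : ℝ → ℝ := fun t => ∫ s in (0:ℝ)..t, g s with hG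
  have hGlim : Tendsto G atTop (nhds m) :=
    intervalIntegral_tendsto_integral_Ioi 0 hgint tendsto_id
  have hGm : ∀ t, 0 ≤ t → G t ≤ m := by
    intro t ht
    simp only [hG, hm]
    rw [intervalIntegral.integral_of_le ht]
    apply setIntegral_mono_set hgint
    · refine (ae_restrict_mem measurableSet_Ioi).mono ?_
      intro s hs
      exact g_nonneg hσ (le_of_lt hs)
    · exact Ioc_subset_Ioi_self.eventuallyLE
  have hGpos : ∀ t, 0 < t → 0 < G t := by
    intro t ht
    apply intervalIntegral.intervalIntegral_pos_of_pos_on (hgii t ht.le) _ ht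
    intro s hs
    exact g_pos hσ hs.1
  have hmpos : 0 < m := (hGpos 1 one_pos).trans_le (hGm 1 zero_le_one)
  have hGmono : ∀ s t, 0 ≤ s → s ≤ t → G s ≤ G t := by
    intro s t hs hst
    apply intervalIntegral.integral_mono_interval le_rfl hs hst _ (hgii t (hs.trans hst))
    refine (ae_restrict_mem measurableSet_Ioc).mono ?_
    intro x hx
    exact g_nonneg hσ hx.1.le
  have hcm : ∀ t, 0 ≤ t → IntervalIntegrable (fun s => R (t - s) * g s) volume 0 t := by
    intro t ht
    apply (hgii t ht).continuousOn_mul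
    fun_prop
  -- upper bound
  have hup : ∀ t, 0 < t → R t * G t ≤ t ^ (α - 1) * (σ * t / (1 + σ * t)) := by
    intro t ht
    rw [← hid t ht]
    simp only [hG]
    rw [← intervalIntegral.integral_const_mul]
    apply intervalIntegral.integral_mono_on ht.le ((hgii t ht.le).const_mul _) (hcm t ht.le)
    intro s hs
    apply mul_le_mul_of_nonneg_right _ (g_nonneg hσ hs.1)
    exact hanti (by simp only [mem_Ici]; linarith [hs.2]) ht.le (by linarith [hs.1])
  have hfrac : ∀ t, 0 < t → σ * t / (1 + σ * t) ≤ 1 := by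
    intro t ht
    rw [div_le_one (by positivity)]; linarith
  have hfraclim : Tendsto (fun t : ℝ => σ * t / (1 + σ * t)) atTop (nhds 1) := by
    have h1 : Tendsto (fun t : ℝ => 1 + σ * t) atTop atTop :=
      tendsto_atTop_add_const_left _ _ (tendsto_id.const_mul_atTop hσ)
    have h2 : Tendsto (fun t : ℝ => 1 - (1 + σ * t)⁻¹) atTop (nhds (1 - 0)) :=
      tendsto_const_nhds.sub h1.inv_tendsto_atTop
    rw [sub_zero] at h2
    refine h2.congr' ?_
    filter_upwards [eventually_gt_atTop 0] with t ht
    have : 1 + σ * t ≠ 0 := by positivity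
    field_simp; ring
  -- crude bound
  obtain ⟨K, hK0, hK⟩ : ∃ K, 0 ≤ K ∧ ∀ s, 0 < s → R s ≤ K * s ^ (α - 1) := by
    refine ⟨max (R 0) (1 / G 1), le_max_of_le_left (hR0 0), fun s hs => ?_⟩
    rcases le_total s 1 with h1 | h1
    · have h2 : 1 ≤ s ^ (α - 1) := one_le_rpow_of_pos_of_le_one_of_nonpos hs h1 (by linarith)
      have h3 : R s ≤ R 0 := hanti (le_refl (0:ℝ)) hs.le hs.le
      calc R s ≤ R 0 * 1 := by linarith
        _ ≤ max (R 0) (1 / G 1) * s ^ (α - 1) := by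
          apply mul_le_mul (le_max_left _ _) h2 zero_le_one (le_max_of_le_left (hR0 0))
    · have h2 := hup s hs
      have hG1 := hGpos 1 one_pos
      have h3 : R s * G 1 ≤ s ^ (α - 1) := by
        calc R s * G 1 ≤ R s * G s :=
              mul_le_mul_of_nonneg_left (hGmono 1 s zero_le_one h1) (hR0 s)
          _ ≤ _ := h2
          _ ≤ s ^ (α - 1) * 1 := mul_le_mul_of_nonneg_left (hfrac s hs) (by positivity)
          _ = _ := mul_one _
      calc R s ≤ 1 / G 1 * s ^ (α - 1) := by
            rw [one_div, inv_mul_eq_div, le_div_iff₀ hG1]; exact h3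
        _ ≤ _ := by gcongr; exact le_max_right _ _
  have hRint : ∀ t, 0 < t → ∫ s in (0:ℝ)..t, R s ≤ K * (t ^ α / α) := by
    intro t ht
    calc ∫ s in (0:ℝ)..t, R s ≤ ∫ s in (0:ℝ)..t, K * s ^ (α - 1) := by
          apply intervalIntegral.integral_mono_on_of_le_Ioo ht.le (hR.intervalIntegrable _ _)
          · exact (intervalIntegral.intervalIntegrable_rpow' (by linarith)).const_mul _
          · intro s hs
            exact hK s hs.1
      _ = _ := by
          rw [intervalIntegral.integral_const_mul, integral_rpow (Or.inl (by linarith))]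
          rw [sub_add_cancel, zero_rpow hα0.ne', sub_zero]
  -- lower bound
  have hlow : ∀ δ t, 0 < δ → δ < 1 → 0 < t →
      t ^ (α - 1) * (σ * t / (1 + σ * t)) ≤
        R ((1 - δ) * t) * m + (δ * t) ^ (α - 2) / σ * (K * (t ^ α / α)) := by
    intro δ t hδ hδ1 ht
    have hδt : 0 < δ * t := by positivity
    have hδtt : δ * t ≤ t := by nlinarith
    rw [← hid t ht]
    have hi1 : IntervalIntegrable (fun s => R (t - s) * g s) volume 0 (δ * t) :=
      (hcm t ht.le).mono_set (by
        rw [uIcc_of_le hδt.le, uIcc_of_le ht.le]; exact Icc_subset_Icc le_rfl hδtt)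
    have hi2 : IntervalIntegrable (fun s => R (t - s) * g s) volume (δ * t) t :=
      (hcm t ht.le).mono_set (by
        rw [uIcc_of_le hδtt, uIcc_of_le ht.le]; exact Icc_subset_Icc hδt.le le_rfl)
    rw [← intervalIntegral.integral_add_adjacent_intervals hi1 hi2]
    apply add_le_add
    · calc ∫ s in (0:ℝ)..(δ * t), R (t - s) * g s
          ≤ ∫ s in (0:ℝ)..(δ * t), R ((1 - δ) * t) * g s := by
            apply intervalIntegral.integral_mono_on hδt.le hi1 ((hgii _ hδt.le).const_mul _)
            intro s hs
            apply mul_le_mul_of_nonneg_right _ (g_nonneg hσ hs.1)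
            apply hanti
            · simp only [mem_Ici]; apply mul_nonneg <;> linarith
            · simp only [mem_Ici]; linarith [hs.2]
            · linarith [hs.2]
        _ = R ((1 - δ) * t) * G (δ * t) := by rw [intervalIntegral.integral_const_mul]
        _ ≤ _ := mul_le_mul_of_nonneg_left (hGm _ hδt.le) (hR0 _)
    · calc ∫ s in (δ * t)..t, R (t - s) * g s
          ≤ ∫ s in (δ * t)..t, R (t - s) * ((δ * t) ^ (α - 2) / σ) := by
            apply intervalIntegral.integral_mono_on hδtt hi2
            · apply Continuous.intervalIntegrable; fun_prop
            · intro s hs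
              apply mul_le_mul_of_nonneg_left _ (hR0 _)
              exact (g_anti hα1 hσ hδt hs.1).trans (g_le hσ hδt)
        _ = (δ * t) ^ (α - 2) / σ * ∫ s in (0:ℝ)..(t - δ * t), R s := by
            rw [intervalIntegral.integral_mul_const, mul_comm,
              intervalIntegral.integral_comp_sub_left (fun x => R x), sub_self]
        _ ≤ (δ * t) ^ (α - 2) / σ * ∫ s in (0:ℝ)..t, R s := by
            apply mul_le_mul_of_nonneg_left _ (by positivity)
            apply intervalIntegral.integral_mono_interval le_rfl (by linarith) (by linarith)
              (Eventually.of_forall hR0) (hR.intervalIntegrable _ _)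
        _ ≤ _ := mul_le_mul_of_nonneg_left (hRint t ht) (by positivity)
  refine ⟨1 / m, by positivity, ?_⟩
  rw [tendsto_order]
  constructor
  · intro L hL
    -- choose δ
    have hcont : Tendsto (fun δ : ℝ => (1 - δ) ^ (1 - α) * (1 / m)) (nhdsWithin 0 (Ioi 0))
        (nhds (1 / m)) := by
      have : ContinuousAt (fun δ : ℝ => (1 - δ) ^ (1 - α) * (1 / m)) 0 := by
        apply ContinuousAt.mul _ continuousAt_const
        apply ContinuousAt.rpow_const (by fun_prop)
        left; norm_num
      have h2 := this.tendsto
      simp only [sub_zero, one_rpow, one_mul] at h2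
      exact h2.mono_left nhdsWithin_le_nhds
    obtain ⟨δ, hδL, hδ0, hδ1⟩ : ∃ δ : ℝ, L < (1 - δ) ^ (1 - α) * (1 / m) ∧ 0 < δ ∧ δ < 1 := by
      have e1 := hcont.eventually_const_lt hL
      have e2 : ∀ᶠ δ : ℝ in nhdsWithin 0 (Ioi 0), δ < 1 :=
        nhdsWithin_le_nhds (Iio_mem_nhds one_pos)
      obtain ⟨δ, h⟩ := (e1.and (e2.and self_mem_nhdsWithin)).exists
      exact ⟨δ, h.1, h.2.2, h.2.1⟩
    have hd : 0 < 1 - δ := by linarith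
    set c := δ ^ (α - 2) / σ * (K / α) with hc
    have hlim : Tendsto (fun t : ℝ => (1 - δ) ^ (1 - α) *
        (1 / m * (σ * t / (1 + σ * t) - c * t ^ (α - 1)))) atTop
        (nhds ((1 - δ) ^ (1 - α) * (1 / m * (1 - c * 0)))) := by
      apply Tendsto.const_mul
      apply Tendsto.const_mul
      apply hfraclim.sub
      apply Tendsto.const_mul
      have := tendsto_rpow_neg_atTop (y := 1 - α) (by linarith)
      simpa using this
    rw [mul_zero, sub_zero, mul_one] at hlim
    have hscale : Tendsto (fun x : ℝ => (1 - δ)⁻¹ * x) atTop atTop :=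
      tendsto_id.const_mul_atTop (by positivity)
    have hev := hscale.eventually ((hlim.eventually_const_lt hδL).and (eventually_gt_atTop 0))
    filter_upwards [hev, eventually_gt_atTop 0] with x hx hx0
    obtain ⟨hx1, ht⟩ := hx
    set t := (1 - δ)⁻¹ * x with htdef
    have hxt : x = (1 - δ) * t := by rw [htdef]; field_simp
    refine hx1.trans_le ?_
    have hl := hlow δ t hδ0 hδ1 ht
    rw [← hxt] at hl
    have hP : 0 < t ^ (α - 1) := by positivity
    have e1 : (δ * t) ^ (α - 2) / σ * (K * (t ^ α / α)) = t ^ (α - 1) * (c * t ^ (α - 1)) := by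
      rw [mul_rpow hδ0.le ht.le, hc]
      have : t ^ (α - 2) * t ^ α = t ^ (α - 1) * t ^ (α - 1) := by
        rw [← rpow_add ht, ← rpow_add ht]; congr 1; ring
      linear_combination (δ ^ (α - 2) / σ * (K / α)) * this
    rw [e1] at hl
    have e2 : x ^ (α - 1) = (1 - δ) ^ (α - 1) * t ^ (α - 1) := by
      rw [hxt, mul_rpow hd.le ht.le]
    have e3 : (1 - δ) ^ (1 - α) = ((1 - δ) ^ (α - 1))⁻¹ := by
      rw [← rpow_neg hd.le]; congr 1; ring
    have hQ : 0 < (1 - δ) ^ (α - 1) := by positivity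
    rw [e2, e3, le_div_iff₀ (by positivity)]
    have : ((1 - δ) ^ (α - 1))⁻¹ * (1 / m * (σ * t / (1 + σ * t) - c * t ^ (α - 1))) *
      ((1 - δ) ^ (α - 1) * t ^ (α - 1)) =
      (t ^ (α - 1) * (σ * t / (1 + σ * t)) - t ^ (α - 1) * (c * t ^ (α - 1))) / m := by
      generalize σ * t / (1 + σ * t) = y
      field_simp
    rw [this, div_le_iff₀ hmpos]
    linarith
  · intro L hL
    have hlim : Tendsto (fun t : ℝ => (σ * t / (1 + σ * t)) / G t) atTop (nhds (1 / m)) :=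
      hfraclim.div hGlim hmpos.ne'
    filter_upwards [hlim.eventually_lt_const hL, eventually_gt_atTop 0] with t h1 ht
    refine lt_of_le_of_lt ?_ h1
    have hP : 0 < t ^ (α - 1) := by positivity
    rw [div_le_div_iff₀ hP (hGpos t ht)]
    linarith [hup t ht]

end asymp

/-- The kernel, extended to be constant on the negatives. -/
noncomputable def rker (α σ : ℝ) (t : ℝ) : ℝ := α * σ * (1 + σ * max t 0) ^ (-(α + 1))

section kernel
variable {α σ : ℝ}

lemma ker_base_pos (hσ : 0 < σ) (t : ℝ) : 0 < 1 + σ * max t 0 := by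
  have := mul_nonneg hσ.le (le_max_right t 0)
  linarith

lemma ker_of_nonneg {t : ℝ} (ht : 0 ≤ t) : rker α σ t = α * σ * (1 + σ * t) ^ (-(α + 1)) := by
  unfold rker; rw [max_eq_left ht]

lemma ker_cont (hσ : 0 < σ) : Continuous (rker α σ) := by
  unfold rker
  apply Continuous.mul continuous_const
  apply Continuous.rpow_const (by fun_prop)
  intro t
  left
  exact (ker_base_pos hσ t).ne'

lemma ker_pos (hα : 0 < α) (hσ : 0 < σ) (t : ℝ) : 0 < rker α σ t := by
  unfold rker
  have := ker_base_pos hσ t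
  positivity

lemma ker_le (hα : 0 < α) (hσ : 0 < σ) (t : ℝ) : rker α σ t ≤ α * σ := by
  unfold rker
  have h : (1 + σ * max t 0) ^ (-(α + 1)) ≤ 1 := by
    apply rpow_le_one_of_one_le_of_nonpos
    · have := mul_nonneg hσ.le (le_max_right t 0)
      linarith
    · linarith
  have : 0 < α * σ := by positivity
  nlinarith

lemma ker_integral (hσ : 0 < σ) {t : ℝ} (ht : 0 ≤ t) :
    ∫ s in (0:ℝ)..t, rker α σ s = 1 - (1 + σ * t) ^ (-α) := by
  have h : ∀ x ∈ uIcc 0 t, HasDerivAt (fun s => -(1 + σ * s) ^ (-α)) (rker α σ x) x := by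
    intro x hx
    rw [uIcc_of_le ht] at hx
    have hb : 0 < 1 + σ * x := by have := mul_nonneg hσ.le hx.1; linarith
    rw [ker_of_nonneg hx.1]
    have h1 : HasDerivAt (fun s => 1 + σ * s) σ x := by
      simpa using ((hasDerivAt_id x).const_mul σ).const_add 1
    have h2 := (h1.rpow_const (p := -α) (Or.inl hb.ne')).neg
    refine h2.congr_deriv ?_
    have : -(α + 1) = -α - 1 := by ring
    rw [this]; ring
  rw [intervalIntegral.integral_eq_sub_of_hasDerivAt h ((ker_cont hσ).intervalIntegrable _ _)]
  simp; ring

lemma ker_logconvex (hα : 0 < α) (hσ : 0 < σ) (a t u : ℝ) (ha : 0 ≤ a) (hat : a ≤ t)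
    (hu : 0 ≤ u) : rker α σ (a + u) * rker α σ t ≤ rker α σ (t + u) * rker α σ a := by
  have ht := ha.trans hat
  rw [ker_of_nonneg (by linarith), ker_of_nonneg ht, ker_of_nonneg (by linarith),
    ker_of_nonneg ha]
  have key : ((1 + σ * (a + u)) * (1 + σ * t)) ^ (-(α + 1)) ≤
      ((1 + σ * (t + u)) * (1 + σ * a)) ^ (-(α + 1)) := by
    apply rpow_le_rpow_of_nonpos (by positivity) _ (by linarith)
    nlinarith [mul_nonneg (mul_nonneg hσ.le hσ.le) (mul_nonneg hu (sub_nonneg.2 hat))]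
  rw [mul_rpow (by positivity) (by positivity), mul_rpow (by positivity) (by positivity)] at key
  have := mul_le_mul_of_nonneg_left key (show 0 ≤ (α * σ) * (α * σ) by positivity)
  linarith

lemma ker_hazard (hα : 0 < α) (hσ : 0 < σ) (t u : ℝ) (ht : 0 ≤ t) (hu : 0 ≤ u) :
    rker α σ (t + u) * (1 + σ * t) ^ (-α) ≤ rker α σ t * (1 + σ * (t + u)) ^ (-α) := by
  rw [ker_of_nonneg (by linarith), ker_of_nonneg ht]
  have hX : 0 < 1 + σ * t := by positivity
  have hY : 0 < 1 + σ * (t + u) := by positivity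
  have e : -(α + 1) = -α + -1 := by ring
  rw [e, rpow_add hX, rpow_add hY, rpow_neg_one, rpow_neg_one]
  have : (1 + σ * (t + u))⁻¹ ≤ (1 + σ * t)⁻¹ := by
    apply inv_anti₀ hX
    nlinarith
  have := mul_le_mul_of_nonneg_left this
    (show 0 ≤ α * σ * (1 + σ * (t + u)) ^ (-α) * (1 + σ * t) ^ (-α) by positivity)
  linarith

lemma ker_conv_rpow (hα : 0 < α) (hσ : 0 < σ) {t : ℝ} (ht : 0 ≤ t) :
    ∫ s in (0:ℝ)..t, rker α σ (t - s) * s ^ (α - 1) = t ^ (α - 1) * (σ * t / (1 + σ * t)) := by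
  rcases ht.eq_or_lt with rfl | ht0
  · simp
  have hD : ∀ s ∈ Icc 0 t, 0 < 1 + σ * (t - s) := by
    intro s hs
    have := mul_nonneg hσ.le (sub_nonneg.2 hs.2)
    linarith
  have hT : 0 < 1 + σ * t := by positivity
  have hcont : ContinuousOn (fun s => (s / (1 + σ * (t - s))) ^ α * (σ / (1 + σ * t)))
      (Icc 0 t) := by
    apply ContinuousOn.mul _ continuousOn_const
    apply ContinuousOn.rpow_const
    · apply ContinuousOn.div (by fun_prop) (by fun_prop)
      intro s hs
      exact (hD s hs).ne'
    · intro s hs; right; exact hα.le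
  have hder : ∀ s ∈ Ioo 0 t, HasDerivAt
      (fun s => (s / (1 + σ * (t - s))) ^ α * (σ / (1 + σ * t)))
      (rker α σ (t - s) * s ^ (α - 1)) s := by
    intro s hs
    have hd := hD s ⟨hs.1.le, hs.2.le⟩
    have hs0 := hs.1
    have h1 : HasDerivAt (fun s => 1 + σ * (t - s)) (-σ) s := by
      simpa using (((hasDerivAt_id s).const_sub t).const_mul σ).const_add 1
    have h2 := (hasDerivAt_id s).div h1 hd.ne'
    have h3 := (h2.rpow_const (p := α) (Or.inl (by
      simp only [Pi.div_apply, id]; positivity))).mul_const (σ / (1 + σ * t))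
    refine h3.congr_deriv ?_
    rw [ker_of_nonneg (by linarith [hs.2])]
    simp only [Pi.div_apply, id]
    rw [div_rpow hs0.le hd.le]
    have e : -(α + 1) = -(α - 1) + (-2 : ℝ) := by ring
    rw [e, rpow_add hd, rpow_neg hd.le, rpow_neg hd.le, rpow_two]
    have e2 : 1 * (1 + σ * (t - s)) - s * -σ = 1 + σ * t := by ring
    rw [e2]
    have hdp : 0 < (1 + σ * (t - s)) ^ (α - 1) := by positivity
    generalize (1 + σ * (t - s)) ^ (α - 1) = p at *
    generalize (1 + σ * (t - s)) = d at *
    field_simp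
  have hint : IntervalIntegrable (fun s => rker α σ (t - s) * s ^ (α - 1)) volume 0 t := by
    apply (intervalIntegral.intervalIntegrable_rpow' (by linarith)).continuousOn_mul
    have := ker_cont (α := α) hσ
    fun_prop
  rw [intervalIntegral.integral_eq_sub_of_hasDerivAt_of_le ht hcont hder hint]
  simp only [sub_self, mul_zero, add_zero, div_one, zero_div, zero_rpow hα.ne', zero_mul, sub_zero]
  have : t ^ α = t ^ (α - 1) * t := by rw [← rpow_add_one ht0.ne']; congr 1; ring
  rw [this]; ring

end kernel

theorem resolvent_regular_variation_at_infinity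
    (α σ : ℝ) (hα : α ∈ Set.Ioo (1/2 : ℝ) 1) (hσ : 0 < σ)
    (φ : ℝ → ℝ) (hφ : ∀ t : ℝ, φ t = α * σ * (1 + σ * t) ^ (-(α + 1)))
    (Rα : ℝ → ℝ) (hRα : ∀ t : ℝ, Rα t = ∑' k : ℕ, convPow φ k t) :
    ∃ C : ℝ, 0 < C ∧ Tendsto (fun t : ℝ => Rα t / t ^ (α - 1)) atTop (nhds C) := by
  have hα0 : 0 < α := by linarith [hα.1]
  have hα1 : α < 1 := hα.2
  have hc : Continuous (rker α σ) := ker_cont hσ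
  have h0 : ∀ t, 0 ≤ rker α σ t := fun t => (ker_pos hα0 hσ t).le
  have hM : ∀ t, rker α σ t ≤ α * σ := ker_le hα0 hσ
  have hFb : ∀ t, 0 ≤ t → 0 < (1 + σ * t) ^ (-α) := by
    intro t ht; positivity
  have hF : ∀ t, 0 ≤ t → ∫ s in (0:ℝ)..t, rker α σ s = 1 - (1 + σ * t) ^ (-α) :=
    fun t ht => ker_integral hσ ht
  have hq : ∀ T, 0 ≤ T → ∫ s in (0:ℝ)..T, rker α σ s < 1 := by
    intro T hT
    rw [hF T hT]; linarith [hFb T hT]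
  set R := renDens (rker α σ) with hRdef
  have hR : Continuous R := renDens_cont hc h0 hM hq
  have hR0 : ∀ t, 0 ≤ R t := renDens_nonneg h0
  have hren : ∀ t, 0 ≤ t → R t = rker α σ t + ∫ s in (0:ℝ)..t, rker α σ (t - s) * R s :=
    renDens_eq hc h0 hM hq
  have hanti : AntitoneOn R (Ici 0) :=
    antitone_of_renewal (Fb := fun t => (1 + σ * t) ^ (-α)) hc (fun t _ => ker_pos hα0 hσ t) hR hR0
      hFb hF hren (ker_logconvex hα0 hσ) (ker_hazard hα0 hσ)
  have hid : ∀ t, 0 < t → ∫ s in (0:ℝ)..t, R (t - s) * (s ^ (α - 1) / (1 + σ * s)) =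
      t ^ (α - 1) * (σ * t / (1 + σ * t)) := by
    intro t ht
    have hr : ∀ t, 0 ≤ t → IntervalIntegrable (fun s : ℝ => s ^ (α - 1)) volume 0 t :=
      fun t _ => intervalIntegral.intervalIntegrable_rpow' (by linarith)
    have hwi : ∀ t, 0 ≤ t → IntervalIntegrable
        (fun s : ℝ => s ^ (α - 1) * (σ * s / (1 + σ * s))) volume 0 t := by
      intro t ht
      apply (hr t ht).mul_continuousOn
      rw [uIcc_of_le ht]
      apply ContinuousOn.div (by fun_prop) (by fun_prop)
      intro s hs
      have := mul_nonneg hσ.le hs.1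
      linarith
    have := renewal_smooth hc hR hren hr hwi (fun t ht => ker_conv_rpow hα0 hσ ht) ht.le
    rw [← this]
    apply intervalIntegral.integral_congr
    intro s hs
    rw [uIcc_of_le ht.le] at hs
    have hb : 1 + σ * s ≠ 0 := by
      have := mul_nonneg hσ.le hs.1
      linarith
    simp only []
    congr 1
    field_simp
    ring
  obtain ⟨C, hC, hlim⟩ := asymp_main hα0 hα1 hσ hR hR0 hanti hid
  refine ⟨C, hC, hlim.congr' ?_⟩
  filter_upwards [eventually_ge_atTop 0] with t ht
  congr 1
  rw [hRα, hRdef, renDens, max_eq_left ht]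
  congr 1
  ext k
  exact convPow_congr (fun s hs => by rw [hφ, ker_of_nonneg hs]) k t ht
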